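/- arXiv:1810.04205 — 2 statements merged into one kernel-verified Lean document; each statement's English description precedes it below -/
import Mathlib

section
/- Let X be a finite dimensional normed space, let Ω be an open subset of X, and let u₀ : cl(Ω) → ℝ be a Lipschitz function such that lip(u₀, ∂Ω) < lip(u₀, cl(Ω)). Then for every ε > 0 there exists a function v : cl(Ω) → ℝ such that v is of class C^∞ on Ω, v is Lipschitz on cl(Ω) with lip(v, cl(Ω)) ≤ lip(u₀, cl(Ω)), v = u₀ on ∂Ω, and |u₀ − v| ≤ ε on cl(Ω). -/
open Metric Set MeasureTheory

/-- `lipOn f s` is the Lipschitz constant of `f` on `s`: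
the infimum of all `L > 0` such that `|f x - f y| ≤ L * dist x y` for all `x, y ∈ s`. -/
noncomputable def lipOn {X : Type*} [PseudoMetricSpace X] (f : X → ℝ) (s : Set X) : ℝ :=
  sInf {L : ℝ | 0 < L ∧ ∀ x ∈ s, ∀ y ∈ s, |f x - f y| ≤ L * dist x y}

/-- `f` is `K`-Lipschitz on `s`. -/
def IsLipschitzWithOn {X : Type*} [PseudoMetricSpace X] (K : ℝ) (f : X → ℝ) (s : Set X) : Prop :=
  ∀ x ∈ s, ∀ y ∈ s, |f x - f y| ≤ K * dist x y

open Filter Topology Function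
open scoped ContDiff NNReal Convolution

/-- In a finite dimensional space, every open set is the support of a smooth nonnegative function
which is dominated, together with its derivative, by a prescribed positive continuous function. -/
theorem IsOpen.exists_contDiff_support_eq_le {E : Type*} [NormedAddCommGroup E] [NormedSpace ℝ E]
    [FiniteDimensional ℝ E] {s : Set E} (hs : IsOpen s) {κ : E → ℝ} (hκ : Continuous κ)
    (κ_pos : ∀ x, 0 < κ x) (κ_le : ∀ x, κ x ≤ 1) :
    ∃ f : E → ℝ, ContDiff ℝ ∞ f ∧ support f = s ∧ (∀ x, 0 ≤ f x) ∧ (∀ x, f x ≤ κ x) ∧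
      ∀ x, ‖fderiv ℝ f x‖ < κ x := by
  rcases eq_empty_or_nonempty s with (rfl | h's)
  · exact ⟨fun _ => 0, contDiff_const, support_fun_zero, fun _ => le_rfl,
      fun x => (κ_pos x).le, fun x => by simpa using κ_pos x⟩
  let ι := { f : E → ℝ // support f ⊆ s ∧ HasCompactSupport f ∧ ContDiff ℝ ∞ f ∧ ∀ x, 0 ≤ f x }
  obtain ⟨T, T_count, hT⟩ : ∃ T : Set ι, T.Countable ∧ ⋃ f ∈ T, support (f : E → ℝ) = s := by
    have : ⋃ f : ι, support (f : E → ℝ) = s := by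
      refine Subset.antisymm (iUnion_subset fun f => f.2.1) fun x hx => ?_
      rcases exists_contDiff_tsupport_subset (n := ⊤) (hs.mem_nhds hx) with ⟨f, hf⟩
      let g : ι := ⟨f, (subset_tsupport f).trans hf.1, hf.2.1, hf.2.2.1,
        fun y => (hf.2.2.2.1 (mem_range_self y)).1⟩
      exact mem_iUnion_of_mem g (by simp [g, hf.2.2.2.2])
    simp_rw [← this]
    exact TopologicalSpace.isOpen_iUnion_countable _
      fun f => f.2.2.2.1.continuous.isOpen_support
  have T_ne : T.Nonempty := by
    rcases eq_empty_or_nonempty T with (rfl | h)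
    · simp [← hT] at h's
    · exact h
  obtain ⟨g, hg⟩ : ∃ g : ℕ → ι, T = range g := T_count.exists_eq_range T_ne
  have g_smooth : ∀ n, ContDiff ℝ ∞ (g n).1 := fun n => (g n).2.2.2.1
  have g_nonneg : ∀ n x, 0 ≤ (g n).1 x := fun n => (g n).2.2.2.2
  obtain ⟨δ, δ_pos, c, hδ, c_lt⟩ := NNReal.exists_pos_sum_of_countable one_ne_zero ℕ
  have hδ' : HasSum (fun n => (δ n : ℝ)) c := NNReal.hasSum_coe.2 hδ
  have : ∀ n : ℕ, ∃ a : ℝ, 0 < a ∧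
      ∀ i ≤ n + 1, ∀ x, ‖iteratedFDeriv ℝ i (a • (g n).1) x‖ ≤ δ n * κ x := by
    intro n
    have : ∀ i : ℕ, ∃ R, 0 ≤ R ∧ ∀ x, ‖iteratedFDeriv ℝ i (g n).1 x‖ ≤ R * κ x := by
      intro i
      have hb : BddAbove (range fun x => (κ x)⁻¹ * ‖iteratedFDeriv ℝ i (g n).1 x‖) := by
        refine ((hκ.inv₀ fun x => (κ_pos x).ne').mul ((g_smooth n).continuous_iteratedFDeriv
          (mod_cast le_top)).norm).bddAbove_range_of_hasCompactSupport ?_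
        exact HasCompactSupport.mul_left
          (HasCompactSupport.comp_left ((g n).2.2.1.iteratedFDeriv i) norm_zero)
      obtain ⟨R, hR⟩ := hb
      refine ⟨max R 0, le_max_right _ _, fun x => ?_⟩
      have h := hR (mem_range_self x)
      rw [inv_mul_le_iff₀ (κ_pos x), mul_comm] at h
      exact h.trans (mul_le_mul_of_nonneg_right (le_max_left _ _) (κ_pos x).le)
    choose R R_nonneg hR using this
    set M := ∑ i ∈ Finset.range (n + 2), R i + 1
    have sum_nonneg : 0 ≤ ∑ i ∈ Finset.range (n + 2), R i := Finset.sum_nonneg fun i _ => R_nonneg i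
    have M_pos : 0 < M := by linarith
    have R_le : ∀ i ≤ n + 1, R i ≤ M := fun i hi => by
      have := Finset.single_le_sum (f := R) (fun i _ => R_nonneg i)
        (Finset.mem_range.2 (show i < n + 2 by omega))
      linarith
    have δn_pos : 0 < δ n := δ_pos n
    refine ⟨M⁻¹ * δ n, by positivity, fun i hi x => ?_⟩
    have hκx := (κ_pos x).le
    calc
      ‖iteratedFDeriv ℝ i ((M⁻¹ * δ n) • (g n).1) x‖
          = ‖(M⁻¹ * δ n) • iteratedFDeriv ℝ i (g n).1 x‖ := by
        rw [iteratedFDeriv_const_smul_apply]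
        exact (g_smooth n).contDiffAt.of_le (mod_cast le_top)
      _ = M⁻¹ * δ n * ‖iteratedFDeriv ℝ i (g n).1 x‖ := by
        rw [norm_smul, Real.norm_of_nonneg (by positivity)]
      _ ≤ M⁻¹ * δ n * (M * κ x) := by
        gcongr
        exact (hR i x).trans (mul_le_mul_of_nonneg_right (R_le i hi) hκx)
      _ = δ n * κ x := by field_simp
  choose a a_pos ha using this
  have ha' : ∀ n, ∀ i ≤ n + 1, ∀ x, ‖iteratedFDeriv ℝ i (a n • (g n).1) x‖ ≤ δ n :=
    fun n i hi x => (ha n i hi x).trans (mul_le_of_le_one_right (δ n).2 (κ_le x))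
  have val_le : ∀ n x, (a n • (g n).1) x ≤ δ n * κ x := fun n x =>
    (le_abs_self _).trans (by simpa only [norm_iteratedFDeriv_zero] using! ha n 0 (by omega) x)
  have val_nonneg : ∀ n x, 0 ≤ (a n • (g n).1) x := fun n x =>
    mul_nonneg (a_pos n).le (g_nonneg n x)
  have sum_bound : ∀ x, HasSum (fun n => δ n * κ x) (c * κ x) := fun x => hδ'.mul_right _
  have S : ∀ x, Summable fun n => (a n • (g n).1) x := fun x =>
    .of_nonneg_of_le (fun n => val_nonneg n x) (fun n => val_le n x) (sum_bound x).summable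
  have c_mul_lt : ∀ x, c * κ x < κ x := fun x => mul_lt_of_lt_one_left (κ_pos x) (mod_cast c_lt)
  refine ⟨fun x => ∑' n, (a n • (g n).1) x, ?_, ?_, fun x => tsum_nonneg fun n => val_nonneg n x,
    fun x => ?_, fun x => ?_⟩
  · refine contDiff_tsum_of_eventually (fun k => (g_smooth k).const_smul (a k))
      (fun k _ => hδ'.summable) fun i _ => ?_
    simp only [Nat.cofinite_eq_atTop, eventually_atTop]
    exact ⟨i, fun n hn x => ha' _ _ (by omega) _⟩
  · apply Subset.antisymm
    · intro x hx
      by_contra h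
      refine hx ?_
      have : ∀ n, (g n).1 x = 0 := fun n => by
        by_contra h'
        exact h ((g n).2.1 h')
      simp [this]
    · intro x hx
      rw [← hT, hg] at hx
      simp only [mem_iUnion, mem_range, exists_prop] at hx
      obtain ⟨_, ⟨n, rfl⟩, hn⟩ := hx
      exact ((S x).tsum_pos (fun i => val_nonneg i x) n
        (mul_pos (a_pos n) ((g_nonneg n x).lt_of_ne' hn))).ne'
  · exact ((S x).tsum_le_tsum (fun n => val_le n x) (sum_bound x).summable).trans
      ((sum_bound x).tsum_eq.trans_lt (c_mul_lt x)).le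
  · have hd : ∀ n x, ‖fderiv ℝ (a n • (g n).1) x‖ ≤ δ n * κ x := fun n x => by
      rw [← norm_iteratedFDeriv_one]
      exact ha n 1 (by omega) x
    rw [fderiv_tsum_apply (f := fun n => a n • (g n).1) hδ'.summable
      (fun n => ((g_smooth n).const_smul (a n)).differentiable (by simp))
      (fun n x => (hd n x).trans (mul_le_of_le_one_right (δ n).2 (κ_le x))) (S x)]
    exact (tsum_of_norm_bounded (sum_bound x) fun n => hd n x).trans_lt (c_mul_lt x)

/-- A function on a normed space whose pointwise Lipschitz constant is at most `L` everywhere is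
`L`-Lipschitz. -/
theorem abs_sub_le_mul_dist_of_eventually {E : Type*} [NormedAddCommGroup E] [NormedSpace ℝ E]
    {f : E → ℝ} {L : ℝ} (hf : ∀ x, ∀ᶠ y in 𝓝 x, |f y - f x| ≤ L * ‖y - x‖) (x y : E) :
    |f x - f y| ≤ L * dist x y := by
  have hcont : Continuous f := continuous_iff_continuousAt.2 fun x => by
    rw [ContinuousAt, tendsto_iff_norm_sub_tendsto_zero]
    have h0 : Tendsto (fun y => L * ‖y - x‖) (𝓝 x) (𝓝 0) := by
      have : Continuous fun y : E => L * ‖y - x‖ := by fun_prop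
      simpa using this.tendsto x
    exact squeeze_zero' (.of_forall fun _ => norm_nonneg _) (hf x) h0
  have key : ∀ x y, f y ≤ f x + L * dist x y := by
    intro x y
    set γ : ℝ → E := fun t => x + t • (y - x) with hγ
    have γ_cont : Continuous γ := by fun_prop
    have := image_le_of_liminf_slope_right_le_deriv_boundary (f := f ∘ γ) (a := 0) (b := 1)
      (B := fun t => f x + t * (L * dist x y)) (B' := fun _ => L * dist x y)
      (hcont.comp γ_cont).continuousOn (by simp [hγ]) (by fun_prop)
      (fun t _ => by
        simpa using (((hasDerivAt_id t).mul_const (L * dist x y)).const_add (f x)).hasDerivWithinAt)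
      (fun t _ r hr => by
        have h1 : ∀ᶠ z in 𝓝[>] t, |f (γ z) - f (γ t)| ≤ L * ‖γ z - γ t‖ :=
          (γ_cont.continuousAt.eventually (hf (γ t))).filter_mono nhdsWithin_le_nhds
        refine (h1.and self_mem_nhdsWithin).frequently.mono ?_
        rintro z ⟨hz, hzt : t < z⟩
        have hnorm : ‖γ z - γ t‖ = (z - t) * dist x y := by
          have : γ z - γ t = (z - t) • (y - x) := by simp only [hγ]; module
          rw [this, norm_smul, Real.norm_of_nonneg (by linarith), dist_comm, dist_eq_norm]
        rw [hnorm] at hz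
        refine lt_of_le_of_lt ?_ hr
        rw [slope_def_field, div_le_iff₀ (by linarith)]
        simp only [comp_apply]
        linarith [le_abs_self (f (γ z) - f (γ t))])
      (show (1 : ℝ) ∈ Icc 0 1 by simp)
    simpa [hγ] using this
  rw [abs_le]
  constructor
  · linarith [key x y]
  · have := key y x
    rw [dist_comm] at this
    linarith

/-- Convolution at a smoothly varying positive scale is smooth. -/
theorem contDiffOn_integral_mul_comp_sub_smul {E : Type*} [NormedAddCommGroup E] [NormedSpace ℝ E]
    [FiniteDimensional ℝ E] [MeasurableSpace E] [BorelSpace E] (μ : Measure E) [μ.IsAddHaarMeasure]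
    {u φ r : E → ℝ} {s : Set E} (hu : Continuous u) (hφ : ContDiff ℝ ∞ φ)
    (hφ_supp : support φ ⊆ closedBall 0 1) (hr : ContDiff ℝ ∞ r) (hr_pos : ∀ x ∈ s, 0 < r x)
    (hr_le : ∀ x, r x ≤ 1) :
    ContDiffOn ℝ ∞ (fun x => ∫ y, φ y * u (x - r x • y) ∂μ) s := by
  set d := Module.finrank ℝ E
  set g : ℝ → E → ℝ := fun p z => (p ^ d)⁻¹ * φ (p⁻¹ • z) with hg
  have hconv : ContDiffOn ℝ ∞
      (fun q : ℝ × E => (u ⋆[ContinuousLinearMap.mul ℝ ℝ, μ] g q.1) q.2) (Ioo 0 2 ×ˢ univ) := by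
    refine contDiffOn_convolution_right_with_param (n := ⊤) _ isOpen_Ioo
      (isCompact_closedBall (0 : E) 2) ?_ hu.locallyIntegrable ?_
    · intro p x hp hx
      have : φ (p⁻¹ • x) = 0 := by
        by_contra h
        refine hx ?_
        have h1 := hφ_supp h
        rw [mem_closedBall_zero_iff, norm_smul, norm_inv, Real.norm_of_nonneg hp.1.le,
          inv_mul_le_iff₀ hp.1] at h1
        rw [mem_closedBall_zero_iff]
        linarith [hp.2]
      simp [hg, this]
    · have hne : ∀ q ∈ Ioo (0 : ℝ) 2 ×ˢ (univ : Set E), q.1 ≠ 0 := fun q hq => hq.1.1.ne'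
      exact ((contDiffOn_fst.pow d).inv fun q hq => pow_ne_zero _ (hne q hq)).mul
        (hφ.comp_contDiffOn ((contDiffOn_fst.inv hne).smul contDiffOn_snd))
  have hcomp := hconv.comp (s := s) (hr.prodMk contDiff_id).contDiffOn
    fun x hx => ⟨⟨hr_pos x hx, (hr_le x).trans_lt one_lt_two⟩, mem_univ _⟩
  refine hcomp.congr fun x hx => ?_
  have hpos := hr_pos x hx
  have h1 := Measure.integral_comp_inv_smul μ (fun y => φ y * u (x - r x • y)) (r x)
  have h2 := integral_sub_left_eq_self (fun t => u (x - t) * g (r x) t) μ x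
  simp only [sub_sub_cancel] at h2
  simp only [comp_apply, convolution_def, ContinuousLinearMap.mul_apply', id]
  rw [h2]
  have h3 : ∀ t, u (x - t) * g (r x) t
      = (r x ^ d)⁻¹ * (φ ((r x)⁻¹ • t) * u (x - r x • (r x)⁻¹ • t)) := fun t => by
    rw [smul_inv_smul₀ hpos.ne']
    simp only [hg]
    ring
  simp_rw [h3]
  rw [integral_const_mul, h1, abs_of_pos (pow_pos hpos _), smul_eq_mul,
    inv_mul_cancel_left₀ (pow_pos hpos _).ne']

/-- Averages of two functions which are `C`-close on the support of the weight are `C`-close. -/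
theorem abs_integral_mul_sub_le {E : Type*} [NormedAddCommGroup E] [MeasurableSpace E]
    [OpensMeasurableSpace E] {μ : Measure E} [IsFiniteMeasureOnCompacts μ] {φ F G : E → ℝ} {C : ℝ}
    (hφ : Continuous φ) (hφ_supp : support φ ⊆ closedBall 0 1) (hφ_comp : HasCompactSupport φ)
    (hφ_nonneg : ∀ y, 0 ≤ φ y) (hφ_int : ∫ y, φ y ∂μ = 1) (hF : Continuous F) (hG : Continuous G)
    (h : ∀ y, ‖y‖ ≤ 1 → |F y - G y| ≤ C) :
    |∫ y, φ y * F y ∂μ - ∫ y, φ y * G y ∂μ| ≤ C := by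
  have hint : ∀ {K : E → ℝ}, Continuous K → Integrable (fun y => φ y * K y) μ := fun hK =>
    (hφ.mul hK).integrable_of_hasCompactSupport hφ_comp.mul_right
  rw [← integral_sub (hint hF) (hint hG)]
  have hle : ∀ y, ‖φ y * F y - φ y * G y‖ ≤ φ y * C := fun y => by
    rw [← mul_sub, norm_mul, Real.norm_of_nonneg (hφ_nonneg y), Real.norm_eq_abs]
    by_cases hy : φ y = 0
    · simp [hy]
    · exact mul_le_mul_of_nonneg_left (h y (mem_closedBall_zero_iff.1 (hφ_supp hy))) (hφ_nonneg y)
  have := norm_integral_le_of_norm_le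
    ((hφ.integrable_of_hasCompactSupport hφ_comp (μ := μ)).mul_const C) (.of_forall hle)
  rwa [integral_mul_const, hφ_int, one_mul, Real.norm_eq_abs] at this

theorem Real.exists_arctan_sub_arctan_eq_mul {H s t : ℝ} (hs : |s| ≤ H) (ht : |t| ≤ H) :
    ∃ τ, (1 + H ^ 2)⁻¹ ≤ τ ∧ τ ≤ 1 ∧ arctan s - arctan t = τ * (s - t) := by
  wlog hst : t ≤ s generalizing s t
  · obtain ⟨τ, h1, h2, h3⟩ := this ht hs (le_of_not_ge hst)
    exact ⟨τ, h1, h2, by linarith⟩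
  rcases hst.eq_or_lt with rfl | hlt
  · exact ⟨1, inv_le_one_of_one_le₀ (by nlinarith [sq_nonneg H]), le_rfl, by simp⟩
  obtain ⟨c, hc, hc'⟩ := exists_hasDerivAt_eq_slope arctan (fun x => 1 / (1 + x ^ 2)) hlt
    continuous_arctan.continuousOn fun x _ => hasDerivAt_arctan x
  refine ⟨1 / (1 + c ^ 2), ?_, ?_, ?_⟩
  · rw [one_div]
    have : |c| ≤ H := abs_le.2 ⟨by linarith [hc.1, (abs_le.1 ht).1],
      by linarith [hc.2, (abs_le.1 hs).2]⟩
    have := sq_le_sq' (abs_le.1 this).1 (abs_le.1 this).2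
    gcongr
  · rw [div_le_one (by positivity)]
    nlinarith [sq_nonneg c]
  · rw [hc', div_mul_cancel₀]
    linarith

/-- Moving `f` slightly towards a function `w` with a smaller Lipschitz constant decreases the
Lipschitz constant on the sets where `f - w` is bounded. -/
theorem abs_sub_mul_arctan_sub_le {E : Type*} [PseudoMetricSpace E] {f w : E → ℝ} {L L₀ a H : ℝ}
    (hL : L₀ ≤ L) (hf : ∀ x y, |f x - f y| ≤ L * dist x y)
    (hw : ∀ x y, |w x - w y| ≤ L₀ * dist x y) (ha : 0 ≤ a) (ha1 : a ≤ 1) {p q : E}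
    (hp : |f p - w p| ≤ H) (hq : |f q - w q| ≤ H) :
    |(f p - a * Real.arctan (f p - w p)) - (f q - a * Real.arctan (f q - w q))|
      ≤ (L - a * (L - L₀) / (1 + H ^ 2)) * dist p q := by
  obtain ⟨τ, h1, h2, h3⟩ := Real.exists_arctan_sub_arctan_eq_mul hp hq
  have hτ : 0 ≤ τ := le_trans (by positivity) h1
  have heq : (f p - a * Real.arctan (f p - w p)) - (f q - a * Real.arctan (f q - w q))
      = (1 - a * τ) * (f p - f q) + a * τ * (w p - w q) := by linear_combination (-a) * h3
  have h4 : 0 ≤ a * τ := mul_nonneg ha hτ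
  have h5 : 0 ≤ 1 - a * τ := by nlinarith
  calc
    _ ≤ (1 - a * τ) * |f p - f q| + a * τ * |w p - w q| := by
      rw [heq]
      refine (abs_add_le _ _).trans_eq ?_
      rw [abs_mul, abs_mul, abs_of_nonneg h4, abs_of_nonneg h5]
    _ ≤ (1 - a * τ) * (L * dist p q) + a * τ * (L₀ * dist p q) := by
      gcongr
      exacts [hf p q, hw p q]
    _ = (L - a * (L - L₀) * τ) * dist p q := by ring
    _ ≤ _ := by
      rw [div_eq_mul_inv]
      have := mul_nonneg ha (sub_nonneg.2 hL)
      gcongr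

theorem isLipschitzWithOn_lipOn {E : Type*} [PseudoMetricSpace E] {f : E → ℝ} {s : Set E}
    (hf : ∃ K, IsLipschitzWithOn K f s) : IsLipschitzWithOn (lipOn f s) f s := by
  obtain ⟨K, hK⟩ := hf
  intro x hx y hy
  rcases (dist_nonneg (x := x) (y := y)).eq_or_lt with h | h
  · simpa [← h] using hK x hx y hy
  · rw [← div_le_iff₀ h]
    refine le_csInf ⟨max K 1, by positivity, fun z hz t ht => ?_⟩ fun M hM => ?_
    · exact (hK z hz t ht).trans (mul_le_mul_of_nonneg_right (le_max_left _ _) dist_nonneg)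
    · exact (div_le_iff₀ h).2 (hM.2 x hx y hy)

theorem lipOn_nonneg {E : Type*} [PseudoMetricSpace E] (f : E → ℝ) (s : Set E) : 0 ≤ lipOn f s :=
  Real.sInf_nonneg fun _ h => h.1.le

theorem lipOn_le {E : Type*} [PseudoMetricSpace E] {f : E → ℝ} {s : Set E} {L : ℝ} (hL : 0 < L)
    (hf : IsLipschitzWithOn L f s) : lipOn f s ≤ L :=
  csInf_le ⟨0, fun _ h => h.1.le⟩ ⟨hL, hf⟩

theorem IsLipschitzWithOn.exists_extension {E : Type*} [PseudoMetricSpace E] {f : E → ℝ}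
    {s : Set E} {L : ℝ} (hL : 0 ≤ L) (hf : IsLipschitzWithOn L f s) :
    ∃ g : E → ℝ, (∀ x y, |g x - g y| ≤ L * dist x y) ∧ EqOn f g s := by
  obtain ⟨g, hg, hfg⟩ := LipschitzOnWith.extend_real (K := ⟨L, hL⟩)
    (LipschitzOnWith.of_dist_le_mul fun x hx y hy => hf x hx y hy)
  exact ⟨g, fun x y => hg.dist_le_mul x y, hfg⟩

/-- Approximation of Lipschitz functions preserving boundary values and the Lipschitz
constant, by functions of class `C^∞`, in a finite dimensional normed space. -/
theorem stmt_0 {X : Type*} [NormedAddCommGroup X] [NormedSpace ℝ X] [FiniteDimensional ℝ X]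
    (Ω : Set X) (hΩ : IsOpen Ω) (u₀ : X → ℝ)
    (hu₀ : ∃ K : ℝ, IsLipschitzWithOn K u₀ (closure Ω))
    (hlt : lipOn u₀ (frontier Ω) < lipOn u₀ (closure Ω))
    (ε : ℝ) (hε : 0 < ε) :
    ∃ v : X → ℝ,
      ContDiffOn ℝ (⊤ : ℕ∞) v Ω ∧
      IsLipschitzWithOn (lipOn u₀ (closure Ω)) v (closure Ω) ∧
      lipOn v (closure Ω) ≤ lipOn u₀ (closure Ω) ∧
      (∀ x ∈ frontier Ω, v x = u₀ x) ∧
      (∀ x ∈ closure Ω, |u₀ x - v x| ≤ ε) := by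
  set L := lipOn u₀ (closure Ω)
  set L₀ := lipOn u₀ (frontier Ω)
  have hL₀ : 0 ≤ L₀ := lipOn_nonneg _ _
  have hL : 0 < L := hL₀.trans_lt hlt
  have hu₀' : ∃ K, IsLipschitzWithOn K u₀ (frontier Ω) := hu₀.imp fun K hK x hx y hy =>
    hK x (frontier_subset_closure hx) y (frontier_subset_closure hy)
  obtain ⟨f, hf, hfu⟩ := (isLipschitzWithOn_lipOn hu₀).exists_extension hL.le
  obtain ⟨w, hw, hwu⟩ := (isLipschitzWithOn_lipOn hu₀').exists_extension hL₀
  have f_cont : Continuous f := (LipschitzWith.of_dist_le_mul (K := ⟨L, hL.le⟩) hf).continuous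
  have w_cont : Continuous w := (LipschitzWith.of_dist_le_mul (K := ⟨L₀, hL₀⟩) hw).continuous
  obtain ⟨a, ha, ha1, haε⟩ : ∃ a : ℝ, 0 < a ∧ a ≤ 1 ∧ a ≤ ε / 4 :=
    ⟨min 1 (ε / 4), by positivity, min_le_left _ _, min_le_right _ _⟩
  set u : X → ℝ := fun x => f x - a * Real.arctan (f x - w x) with hu
  have u_cont : Continuous u := by fun_prop
  have u_close : ∀ x, |f x - u x| ≤ ε / 2 := fun x => by
    have harc : |Real.arctan (f x - w x)| ≤ 2 := abs_le.2
      ⟨by linarith [Real.neg_pi_div_two_lt_arctan (f x - w x), Real.pi_le_four],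
        by linarith [Real.arctan_lt_pi_div_two (f x - w x), Real.pi_le_four]⟩
    calc |f x - u x| = a * |Real.arctan (f x - w x)| := by
          rw [hu, sub_sub_cancel, abs_mul, abs_of_pos ha]
      _ ≤ ε / 4 * 2 := by gcongr
      _ = ε / 2 := by ring
  have u_lip : ∀ x y, |u x - u y| ≤ L * dist x y := fun x y =>
    (abs_sub_mul_arctan_sub_le hlt.le hf hw ha.le ha1
      (le_max_left |f x - w x| |f y - w y|) (le_max_right _ _)).trans <| by
        have : 0 ≤ a * (L - L₀) / (1 + max |f x - w x| |f y - w y| ^ 2) :=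
          div_nonneg (mul_nonneg ha.le (sub_nonneg.2 hlt.le)) (by positivity)
        gcongr
        linarith
  set H : X → ℝ := fun x => |f 0 - w 0| + 2 * L * (‖x‖ + 2) with hH
  have H_bound : ∀ x p, ‖p‖ ≤ ‖x‖ + 2 → |f p - w p| ≤ H x := fun x p hp => by
    have h1 := hf p 0
    have h2 := hw p 0
    rw [dist_zero_right] at h1 h2
    have h3 : L₀ * ‖p‖ ≤ L * ‖p‖ := by gcongr
    have h4 : L * ‖p‖ ≤ L * (‖x‖ + 2) := by gcongr
    calc |f p - w p| = |(f 0 - w 0) + (f p - f 0) - (w p - w 0)| := by ring_nf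
      _ ≤ |f 0 - w 0| + |f p - f 0| + |w p - w 0| :=
          (abs_sub _ _).trans (add_le_add_left (abs_add_le _ _) _)
      _ ≤ H x := by simp only [hH]; linarith
  set m : X → ℝ := fun x => a * (L - L₀) / (1 + H x ^ 2)
  have m_pos : ∀ x, 0 < m x := fun x =>
    div_pos (mul_pos ha (sub_pos.2 hlt)) (by positivity)
  have m_cont : Continuous m :=
    continuous_const.div (by fun_prop) fun x => (by positivity : (0 : ℝ) < 1 + H x ^ 2).ne'
  set κ : X → ℝ := fun x => min 1 (min (ε / (2 * L)) (m x / L))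
  have κ_le_one : ∀ x, κ x ≤ 1 := fun x => min_le_left _ _
  have κ_le_ε : ∀ x, L * κ x ≤ ε / 2 := fun x => by
    have : κ x ≤ ε / (2 * L) := (min_le_right _ _).trans (min_le_left _ _)
    rw [le_div_iff₀ (by positivity)] at this
    linarith
  have κ_le_m : ∀ x, L * κ x ≤ m x := fun x => by
    have : κ x ≤ m x / L := (min_le_right _ _).trans (min_le_right _ _)
    rw [le_div_iff₀ hL] at this
    linarith
  obtain ⟨r, r_smooth, r_supp, r_nonneg, r_le, r_deriv⟩ :=
    hΩ.exists_contDiff_support_eq_le (κ := κ) (by fun_prop)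
      (fun x => lt_min one_pos (lt_min (by positivity) (div_pos (m_pos x) hL))) κ_le_one
  have r_le_one : ∀ x, r x ≤ 1 := fun x => (r_le x).trans (κ_le_one x)
  borelize X
  let μ : Measure X := Measure.addHaar
  let b : ContDiffBump (0 : X) := ⟨1 / 2, 1, by norm_num, by norm_num⟩
  set φ : X → ℝ := b.normed μ
  have φ_supp : support φ ⊆ closedBall 0 1 :=
    b.support_normed_eq.trans_subset ball_subset_closedBall
  set v : X → ℝ := fun x => ∫ y, φ y * u (x - r x • y) ∂μ
  have average : ∀ {F G : X → ℝ} {C : ℝ}, Continuous F → Continuous G →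
      (∀ y, ‖y‖ ≤ 1 → |F y - G y| ≤ C) → |∫ y, φ y * F y ∂μ - ∫ y, φ y * G y ∂μ| ≤ C :=
    abs_integral_mul_sub_le b.continuous_normed φ_supp b.hasCompactSupport_normed
      b.nonneg_normed b.integral_normed
  have v_close : ∀ x, |u x - v x| ≤ L * r x := fun x => by
    have := average (F := fun _ => u x) (G := fun y => u (x - r x • y)) (C := L * r x)
      (by fun_prop) (by fun_prop) fun y hy => by
        refine (u_lip _ _).trans ?_
        rw [dist_self_sub_right, norm_smul, Real.norm_of_nonneg (r_nonneg x)]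
        gcongr
        exact mul_le_of_le_one_right (r_nonneg x) hy
    rwa [integral_mul_const, b.integral_normed, one_mul] at this
  have v_lip : ∀ x y, |v x - v y| ≤ L * dist x y := by
    refine abs_sub_le_mul_dist_of_eventually fun x => ?_
    have hr : ∀ᶠ z in 𝓝 x, |r z - r x| ≤ κ x * ‖z - x‖ := by
      have h1 := (r_smooth.differentiable (by simp) x).hasFDerivAt.isLittleO.def
        (sub_pos.2 (r_deriv x))
      filter_upwards [h1] with z hz
      have h2 := (fderiv ℝ r x).le_opNorm (z - x)
      calc |r z - r x| = ‖(r z - r x - fderiv ℝ r x (z - x)) + fderiv ℝ r x (z - x)‖ := by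
            rw [sub_add_cancel, Real.norm_eq_abs]
        _ ≤ (κ x - ‖fderiv ℝ r x‖) * ‖z - x‖ + ‖fderiv ℝ r x‖ * ‖z - x‖ :=
            (norm_add_le _ _).trans (add_le_add hz h2)
        _ = κ x * ‖z - x‖ := by ring
    filter_upwards [hr, ball_mem_nhds x one_pos] with z hz hzx
    refine average (by fun_prop) (by fun_prop) fun y hy => ?_
    have hzx' : ‖z‖ ≤ ‖x‖ + 1 := by
      rw [mem_ball, dist_eq_norm] at hzx
      linarith [norm_le_norm_add_norm_sub' z x]
    have shift : ∀ p, ‖p‖ ≤ ‖x‖ + 1 → ‖p - r p • y‖ ≤ ‖x‖ + 2 := fun p hp => by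
      have : ‖r p • y‖ ≤ 1 := by
        rw [norm_smul, Real.norm_of_nonneg (r_nonneg p)]
        exact mul_le_one₀ (r_le_one p) (norm_nonneg _) hy
      linarith [norm_sub_le p (r p • y)]
    have hd : dist (z - r z • y) (x - r x • y) ≤ (1 + κ x) * ‖z - x‖ := by
      rw [dist_eq_norm]
      calc ‖z - r z • y - (x - r x • y)‖ = ‖(z - x) - (r z - r x) • y‖ := by
            congr 1
            module
        _ ≤ ‖z - x‖ + |r z - r x| * ‖y‖ := by
            rw [← Real.norm_eq_abs, ← norm_smul]
            exact norm_sub_le _ _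
        _ ≤ ‖z - x‖ + κ x * ‖z - x‖ :=
            add_le_add_right ((mul_le_of_le_one_right (abs_nonneg _) hy).trans hz) _
        _ = (1 + κ x) * ‖z - x‖ := by ring
    have hbound := abs_sub_mul_arctan_sub_le hlt.le hf hw ha.le ha1
      (H_bound x _ (shift z hzx')) (H_bound x _ (shift x (by linarith)))
    have hm_le : m x ≤ L := by
      refine (div_le_self (mul_nonneg ha.le (sub_nonneg.2 hlt.le)) ?_).trans ?_
      · nlinarith [sq_nonneg (H x)]
      · nlinarith
    calc |u (z - r z • y) - u (x - r x • y)|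
        ≤ (L - m x) * dist (z - r z • y) (x - r x • y) := hbound
      _ ≤ (L - m x) * ((1 + κ x) * ‖z - x‖) :=
          mul_le_mul_of_nonneg_left hd (sub_nonneg.2 hm_le)
      _ = ((L - m x) * (1 + κ x)) * ‖z - x‖ := by ring
      _ ≤ L * ‖z - x‖ := by
          gcongr
          have hκ_nonneg : 0 ≤ κ x := (r_nonneg x).trans (r_le x)
          nlinarith [κ_le_m x, mul_nonneg (m_pos x).le hκ_nonneg]
  have v_lip' : IsLipschitzWithOn L v (closure Ω) := fun x _ y _ => v_lip x y
  refine ⟨v, ?_, v_lip', lipOn_le hL v_lip', fun x hx => ?_, fun x hx => ?_⟩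
  · refine contDiffOn_integral_mul_comp_sub_smul μ u_cont b.contDiff_normed φ_supp r_smooth
      (fun x hx => (r_nonneg x).lt_of_ne' ?_) r_le_one
    rwa [← mem_support, r_supp]
  · have hr0 : r x = 0 := by
      rw [← notMem_support, r_supp]
      rw [hΩ.frontier_eq] at hx
      exact hx.2
    have h1 := v_close x
    rw [hr0, mul_zero] at h1
    have h2 : f x = w x := (hfu (frontier_subset_closure hx)).symm.trans (hwu hx)
    rw [← sub_eq_zero.1 (abs_nonpos_iff.1 h1), hfu (frontier_subset_closure hx)]
    simp [hu, h2]
  · rw [hfu hx]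
    have h1 := (v_close x).trans ((mul_le_mul_of_nonneg_left (r_le x) hL.le).trans (κ_le_ε x))
    linarith [abs_sub_le (f x) (u x) (v x), u_close x]
end

section
/- Let X be a (not necessarily separable) Hilbert space, let Ω be an open subset of X, and let u₀ : cl(Ω) → ℝ be a Lipschitz function such that lip(u₀, ∂Ω) < lip(u₀, cl(Ω)). Then for every ε > 0 there exists a function v : cl(Ω) → ℝ such that v is of class C¹ on Ω, v is Lipschitz on cl(Ω) with lip(v, cl(Ω)) ≤ lip(u₀, cl(Ω)), v = u₀ on ∂Ω, and |u₀ − v| ≤ ε on cl(Ω). -/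
open Metric Set MeasureTheory

open Filter Topology

section Extension

theorem IsLipschitzWithOn.exists_extension_s3 {X : Type*} [PseudoMetricSpace X] {K : ℝ} {f : X → ℝ}
    {s : Set X} (hK : 0 ≤ K) (hf : IsLipschitzWithOn K f s) :
    ∃ g : X → ℝ, IsLipschitzWithOn K g univ ∧ EqOn f g s := by
  lift K to NNReal using hK
  have h : LipschitzOnWith K f s :=
    LipschitzOnWith.of_dist_le_mul fun x hx y hy => hf x hx y hy
  obtain ⟨g, hg, hfg⟩ := h.extend_real
  exact ⟨g, fun x _ y _ => hg.dist_le_mul x y, hfg⟩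

theorem IsLipschitzWithOn.continuous {X : Type*} [PseudoMetricSpace X] {K : ℝ} {f : X → ℝ}
    (hf : IsLipschitzWithOn K f univ) : Continuous f :=
  (LipschitzWith.of_dist_le' fun x y => hf x trivial y trivial).continuous

end Extension

section Smooth

variable {X : Type*} [NormedAddCommGroup X] [NormedSpace ℝ X]

/-- A Lipschitz function whose mixed second differences are quadratically small is `C¹`. -/
theorem contDiff_one_of_abs_second_difference_le {g : X → ℝ} {L C : ℝ} (hC : 0 ≤ C)
    (hL : IsLipschitzWithOn L g univ)
    (hg : ∀ x h k, |g (x + h + k) - g (x + h) - g (x + k) + g x| ≤ C * (‖h‖ ^ 2 + ‖k‖ ^ 2)) :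
    ContDiff ℝ 1 g := by
  set q : X → X → ℕ → ℝ := fun x h n => 2 ^ n * (g (x + ((1 : ℝ) / 2 ^ n) • h) - g x) with hq
  have hstep : ∀ x h n, dist (q x h n) (q x h (n + 1)) ≤ C * ‖h‖ ^ 2 / 2 / 2 ^ n := by
    intro x h n
    set k : X := ((1 : ℝ) / 2 ^ (n + 1)) • h with hk
    have hkk : ((1 : ℝ) / 2 ^ n) • h = k + k := by
      rw [hk, ← add_smul]; congr 1; rw [pow_succ]; field_simp; norm_num
    have h1 := hg x k k
    have hnk : ‖k‖ = 1 / 2 ^ (n + 1) * ‖h‖ := by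
      rw [hk, norm_smul, Real.norm_of_nonneg (by positivity)]
    have h2 : q x h n - q x h (n + 1) = 2 ^ n * (g (x + k + k) - g (x + k) - g (x + k) + g x) := by
      simp only [hq, hkk, ← hk, add_assoc]; ring
    rw [Real.dist_eq, h2, abs_mul, abs_of_nonneg (by positivity : (0 : ℝ) ≤ 2 ^ n)]
    calc (2 : ℝ) ^ n * _ ≤ 2 ^ n * (C * (‖k‖ ^ 2 + ‖k‖ ^ 2)) := by gcongr
      _ = C * ‖h‖ ^ 2 / 2 / 2 ^ n := by
        rw [hnk, pow_succ]; field_simp; ring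
  have hlim : ∀ x h, ∃ a, Tendsto (q x h) atTop (𝓝 a) := fun x h =>
    cauchySeq_tendsto_of_complete (cauchySeq_of_le_geometric_two (hstep x h))
  choose D hD using hlim
  have hpow : Tendsto (fun n : ℕ => ((1 : ℝ) / 2) ^ n) atTop (𝓝 0) :=
    tendsto_pow_atTop_nhds_zero_of_lt_one (by norm_num) (by norm_num)
  have happrox : ∀ x h, |g (x + h) - g x - D x h| ≤ C * ‖h‖ ^ 2 := by
    intro x h
    have := dist_le_of_le_geometric_two_of_tendsto₀ (hstep x h) (hD x h)
    simpa [Real.dist_eq, hq, sub_sub, add_comm] using this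
  have hbound : ∀ x h, ‖D x h‖ ≤ L * ‖h‖ := by
    intro x h
    refine le_of_tendsto (hD x h).norm (Eventually.of_forall fun n => ?_)
    have := hL (x + ((1 : ℝ) / 2 ^ n) • h) trivial x trivial
    rw [dist_eq_norm, add_sub_cancel_left, norm_smul, Real.norm_of_nonneg (by positivity)] at this
    simp only [hq, Real.norm_eq_abs, abs_mul, abs_of_nonneg (by positivity : (0 : ℝ) ≤ 2 ^ n)]
    calc (2 : ℝ) ^ n * _ ≤ 2 ^ n * (L * (1 / 2 ^ n * ‖h‖)) := by gcongr
      _ = L * ‖h‖ := by field_simp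
  have hadd : ∀ x h k, D x (h + k) = D x h + D x k := by
    intro x h k
    have h1 : Tendsto (fun n => q x (h + k) n - q x h n - q x k n) atTop
        (𝓝 (D x (h + k) - D x h - D x k)) := ((hD x _).sub (hD x _)).sub (hD x _)
    have h2 : Tendsto (fun n => q x (h + k) n - q x h n - q x k n) atTop (𝓝 0) := by
      refine squeeze_zero_norm (a := fun n => C * (‖h‖ ^ 2 + ‖k‖ ^ 2) * (1 / 2) ^ n)
        (fun n => ?_) (by simpa using hpow.const_mul (C * (‖h‖ ^ 2 + ‖k‖ ^ 2)))
      have h3 := hg x (((1 : ℝ) / 2 ^ n) • h) (((1 : ℝ) / 2 ^ n) • k)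
      rw [norm_smul, norm_smul, Real.norm_of_nonneg (by positivity)] at h3
      have h4 : q x (h + k) n - q x h n - q x k n = 2 ^ n *
          (g (x + ((1 : ℝ) / 2 ^ n) • h + ((1 : ℝ) / 2 ^ n) • k) - g (x + ((1 : ℝ) / 2 ^ n) • h)
            - g (x + ((1 : ℝ) / 2 ^ n) • k) + g x) := by
        simp only [hq, smul_add, add_assoc]; ring
      rw [h4, norm_mul, Real.norm_of_nonneg (by positivity : (0 : ℝ) ≤ 2 ^ n), Real.norm_eq_abs]
      calc (2 : ℝ) ^ n * _
          ≤ 2 ^ n * (C * ((1 / 2 ^ n * ‖h‖) ^ 2 + (1 / 2 ^ n * ‖k‖) ^ 2)) := by gcongr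
        _ = C * (‖h‖ ^ 2 + ‖k‖ ^ 2) * (1 / 2) ^ n := by
          rw [one_div_pow (2 : ℝ) n]; field_simp
    have := tendsto_nhds_unique h1 h2
    linarith
  let A : X → X →+ ℝ := fun x => AddMonoidHom.mk' (D x) (hadd x)
  let F : X → X →L[ℝ] ℝ := fun x =>
    (A x).toRealLinearMap (AddMonoidHomClass.continuous_of_bound (A x) L (hbound x))
  have hF : ∀ x h, F x h = D x h := fun x h => rfl
  have hlip : ∀ x y, ‖F x - F y‖ ≤ 4 * C * ‖x - y‖ := by
    intro x y
    refine ContinuousLinearMap.opNorm_le_bound _ (by positivity) fun h => ?_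
    rcases eq_or_ne h 0 with rfl | hh
    · simp
    rcases eq_or_ne x y with rfl | hxy
    · simp
    have hh' : 0 < ‖h‖ := norm_pos_iff.2 hh
    have hxy' : 0 < ‖x - y‖ := norm_pos_iff.2 (sub_ne_zero.2 hxy)
    set s : ℝ := ‖x - y‖ / ‖h‖ with hs
    have hs0 : 0 < s := by positivity
    have hns : ‖s • h‖ = ‖x - y‖ := by
      rw [norm_smul, Real.norm_of_nonneg hs0.le, hs]; field_simp
    have h1 := happrox x (s • h)
    have h2 := happrox y (s • h)
    have h3 := hg y (s • h) (x - y)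
    have e1 : y + s • h + (x - y) = x + s • h := by abel
    have e2 : y + (x - y) = x := by abel
    rw [e1, e2] at h3
    rw [hns] at h1 h2 h3
    have h4 : |D x (s • h) - D y (s • h)| ≤ 4 * C * ‖x - y‖ ^ 2 := by
      rw [abs_le] at *; constructor <;> linarith
    have h5 : D x (s • h) - D y (s • h) = s * (F x - F y) h := by
      rw [← hF, ← hF, map_smul, map_smul, sub_apply, smul_eq_mul,
        smul_eq_mul]
      ring
    rw [h5, abs_mul, abs_of_pos hs0, hs] at h4
    rw [Real.norm_eq_abs]
    have h6 : ‖x - y‖ * |(F x - F y) h| ≤ ‖x - y‖ * (4 * C * ‖x - y‖ * ‖h‖) := by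
      calc ‖x - y‖ * |(F x - F y) h| = (‖x - y‖ / ‖h‖ * |(F x - F y) h|) * ‖h‖ := by field_simp
        _ ≤ 4 * C * ‖x - y‖ ^ 2 * ‖h‖ := by gcongr
        _ = _ := by ring
    exact le_of_mul_le_mul_left h6 hxy'
  refine contDiff_one_iff_hasFDerivAt.2 ⟨F, ?_, fun x => ?_⟩
  · exact (LipschitzWith.of_dist_le' (K := 4 * C) fun x y => by
      simpa [dist_eq_norm] using hlip x y).continuous
  · rw [hasFDerivAt_iff_isLittleO_nhds_zero]
    refine Asymptotics.IsBigO.trans_isLittleO (g := fun h : X => ‖h‖ ^ 2) ?_ ?_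
    · refine Asymptotics.IsBigO.of_bound C (Eventually.of_forall fun h => ?_)
      rw [Real.norm_of_nonneg (by positivity : (0 : ℝ) ≤ ‖h‖ ^ 2)]
      exact happrox x h
    · simpa using Asymptotics.isLittleO_norm_pow_id (E' := X) (n := 2) (by norm_num)

end Smooth

section InfConvolution

variable {X : Type*} [NormedAddCommGroup X]

/-- The infimal convolution of `f` with the quadratic kernel `z ↦ c * ‖z‖ ^ 2`. -/
noncomputable def quadInfConv (c : ℝ) (f : X → ℝ) (x : X) : ℝ :=
  ⨅ z, (f (x + z) + c * ‖z‖ ^ 2)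

variable {c L : ℝ} {f : X → ℝ}

theorem sub_le_add_quad (hc : 0 < c) (hf : IsLipschitzWithOn L f univ) (x z : X) :
    f x - L ^ 2 / (4 * c) ≤ f (x + z) + c * ‖z‖ ^ 2 := by
  have h1 := hf x trivial (x + z) trivial
  rw [dist_eq_norm, sub_add_cancel_left, norm_neg] at h1
  have h2 : L * ‖z‖ ≤ L ^ 2 / (4 * c) + c * ‖z‖ ^ 2 := by
    have : L ^ 2 / (4 * c) + c * ‖z‖ ^ 2 - L * ‖z‖ = (L - 2 * c * ‖z‖) ^ 2 / (4 * c) := by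
      field_simp; ring
    have h3 : 0 ≤ (L - 2 * c * ‖z‖) ^ 2 / (4 * c) := by positivity
    linarith
  linarith [le_abs_self (f x - f (x + z))]

theorem quadInfConv_le_add (hc : 0 < c) (hf : IsLipschitzWithOn L f univ) (x z : X) :
    quadInfConv c f x ≤ f (x + z) + c * ‖z‖ ^ 2 :=
  ciInf_le ⟨f x - L ^ 2 / (4 * c), by
    rintro _ ⟨z, rfl⟩; exact sub_le_add_quad hc hf x z⟩ z

theorem quadInfConv_le (hc : 0 < c) (hf : IsLipschitzWithOn L f univ) (x : X) :
    quadInfConv c f x ≤ f x := by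
  simpa using quadInfConv_le_add hc hf x 0

theorem sub_le_quadInfConv (hc : 0 < c) (hf : IsLipschitzWithOn L f univ) (x : X) :
    f x - L ^ 2 / (4 * c) ≤ quadInfConv c f x :=
  le_ciInf fun z => sub_le_add_quad hc hf x z

theorem abs_sub_quadInfConv_le (hc : 0 < c) (hf : IsLipschitzWithOn L f univ) (x : X) :
    |f x - quadInfConv c f x| ≤ L ^ 2 / (4 * c) := by
  rw [abs_of_nonneg (sub_nonneg.2 (quadInfConv_le hc hf x))]
  linarith [sub_le_quadInfConv hc hf x]

theorem exists_add_quad_lt (c : ℝ) (f : X → ℝ) (x : X) {τ : ℝ} (hτ : 0 < τ) :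
    ∃ z, f (x + z) + c * ‖z‖ ^ 2 < quadInfConv c f x + τ :=
  exists_lt_of_ciInf_lt (lt_add_of_pos_right _ hτ)

theorem isLipschitzWithOn_quadInfConv (hc : 0 < c) (hf : IsLipschitzWithOn L f univ) :
    IsLipschitzWithOn L (quadInfConv c f) univ := by
  have key : ∀ x y, quadInfConv c f x - quadInfConv c f y ≤ L * dist x y := by
    intro x y
    refine le_of_forall_pos_le_add fun τ hτ => ?_
    obtain ⟨z, hz⟩ := exists_add_quad_lt c f y hτ
    have h1 := quadInfConv_le_add hc hf x z
    have h2 := hf (x + z) trivial (y + z) trivial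
    rw [dist_add_right] at h2
    linarith [le_abs_self (f (x + z) - f (y + z))]
  intro x _ y _
  rw [abs_sub_le_iff]
  exact ⟨key x y, dist_comm x y ▸ key y x⟩

theorem IsLipschitzWithOn.neg {X : Type*} [PseudoMetricSpace X] {L : ℝ} {f : X → ℝ} {s : Set X}
    (hf : IsLipschitzWithOn L f s) : IsLipschitzWithOn L (fun x => -f x) s := by
  intro x hx y hy
  rw [neg_sub_neg, abs_sub_comm]
  exact hf x hx y hy

end InfConvolution

section LasryLions

variable {X : Type*} [NormedAddCommGroup X] [InnerProductSpace ℝ X] {c L : ℝ} {f : X → ℝ}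

theorem norm_add_sq_add_norm_sub_sq (x y : X) :
    ‖x + y‖ ^ 2 + ‖x - y‖ ^ 2 = 2 * (‖x‖ ^ 2 + ‖y‖ ^ 2) := by
  have := parallelogram_law_with_norm ℝ x y
  nlinarith

theorem quadInfConv_second_difference_le (hc : 0 < c) (hf : IsLipschitzWithOn L f univ) (x h : X) :
    quadInfConv c f (x + h) + quadInfConv c f (x - h) - 2 * quadInfConv c f x
      ≤ 2 * c * ‖h‖ ^ 2 := by
  refine le_of_forall_pos_le_add fun τ hτ => ?_
  obtain ⟨z, hz⟩ := exists_add_quad_lt c f x (half_pos hτ)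
  have h1 := quadInfConv_le_add hc hf (x + h) (z - h)
  have h2 := quadInfConv_le_add hc hf (x - h) (z + h)
  rw [add_add_sub_cancel] at h1
  rw [sub_add_add_cancel] at h2
  have h3 := congrArg (c * ·) (norm_add_sq_add_norm_sub_sq z h)
  linarith

/-- Infimal convolution with a sufficiently steep quadratic kernel preserves semiconvexity. -/
theorem le_quadInfConv_second_difference (hc : 0 < c) (hf : IsLipschitzWithOn L f univ)
    (hconv : ∀ x h, -(2 * c * ‖h‖ ^ 2) ≤ f (x + h) + f (x - h) - 2 * f x) (x h : X) :
    -(4 * c * ‖h‖ ^ 2) ≤ quadInfConv (2 * c) f (x + h) + quadInfConv (2 * c) f (x - h)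
      - 2 * quadInfConv (2 * c) f x := by
  refine le_of_forall_pos_le_add fun τ hτ => ?_
  obtain ⟨z, hz⟩ := exists_add_quad_lt (2 * c) f (x + h) (half_pos hτ)
  obtain ⟨w, hw⟩ := exists_add_quad_lt (2 * c) f (x - h) (half_pos hτ)
  set m : X := (2⁻¹ : ℝ) • (z + w) with hm
  set d : X := (2⁻¹ : ℝ) • (z - w) with hd
  have hz' : z = m + d := by rw [hm, hd]; module
  have hw' : w = m - d := by rw [hm, hd]; module
  have h1 := quadInfConv_le_add (by positivity : 0 < 2 * c) hf x m
  have h2 := hconv (x + m) (h + d)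
  rw [show x + m + (h + d) = x + h + z by rw [hz']; abel,
    show x + m - (h + d) = x - h + w by rw [hw']; abel] at h2
  have h3 := congrArg (c * ·) (norm_add_sq_add_norm_sub_sq m d)
  rw [← hz', ← hw'] at h3
  have h4 := congrArg (c * ·) (norm_add_sq_add_norm_sub_sq h d)
  have h5 : 0 ≤ c * ‖h - d‖ ^ 2 := by positivity
  linarith

theorem abs_second_difference_le_of_symmetric {C : ℝ} {g : X → ℝ}
    (hg : ∀ x h, |g (x + h) + g (x - h) - 2 * g x| ≤ C * ‖h‖ ^ 2) (x h k : X) :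
    |g (x + h + k) - g (x + h) - g (x + k) + g x| ≤ C * (‖h‖ ^ 2 + ‖k‖ ^ 2) := by
  set m : X := x + (2⁻¹ : ℝ) • (h + k) with hm
  have h1 := hg m ((2⁻¹ : ℝ) • (h + k))
  have h2 := hg m ((2⁻¹ : ℝ) • (h - k))
  rw [show m + (2⁻¹ : ℝ) • (h + k) = x + h + k by rw [hm]; module,
    show m - (2⁻¹ : ℝ) • (h + k) = x by rw [hm]; module, norm_smul,
    Real.norm_of_nonneg (by norm_num)] at h1
  rw [show m + (2⁻¹ : ℝ) • (h - k) = x + h by rw [hm]; module,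
    show m - (2⁻¹ : ℝ) • (h - k) = x + k by rw [hm]; module, norm_smul,
    Real.norm_of_nonneg (by norm_num)] at h2
  have h3 := congrArg (C * ·) (norm_add_sq_add_norm_sub_sq h k)
  have h4 := (abs_nonneg _).trans h1
  have h5 := (abs_nonneg _).trans h2
  rw [abs_le] at *
  constructor <;> linarith

/-- **Lasry–Lions regularization**: a Lipschitz function on an inner product space is a uniform
limit of `C¹` functions with the same Lipschitz constant. -/
theorem IsLipschitzWithOn.exists_contDiff_one_approx (hf : IsLipschitzWithOn L f univ) {η : ℝ}
    (hη : 0 < η) :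
    ∃ g : X → ℝ, ContDiff ℝ 1 g ∧ IsLipschitzWithOn L g univ ∧ ∀ x, |f x - g x| ≤ η := by
  set c : ℝ := (L ^ 2 + 1) / (2 * η) with hc_def
  have hc : 0 < c := by positivity
  have hcη : L ^ 2 / (4 * c) ≤ η / 2 := by
    rw [div_le_iff₀ (by positivity), hc_def]
    have : η / 2 * (4 * ((L ^ 2 + 1) / (2 * η))) = L ^ 2 + 1 := by field_simp; norm_num
    linarith
  have hcη' : L ^ 2 / (4 * (2 * c)) ≤ η / 2 := by
    refine le_trans ?_ hcη
    gcongr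
    linarith
  obtain ⟨u, hu⟩ : ∃ u : X → ℝ, ∀ x, u x = -quadInfConv c f x := ⟨_, fun _ => rfl⟩
  have hu_lip : IsLipschitzWithOn L u univ := by
    rw [funext hu]
    exact (isLipschitzWithOn_quadInfConv hc hf).neg
  have hu_conv : ∀ x h, -(2 * c * ‖h‖ ^ 2) ≤ u (x + h) + u (x - h) - 2 * u x := by
    intro x h
    have := quadInfConv_second_difference_le hc hf x h
    rw [hu, hu, hu]
    linarith
  have h2c : 0 < 2 * c := by positivity
  obtain ⟨g, hg⟩ : ∃ g : X → ℝ, ∀ x, g x = -quadInfConv (2 * c) u x := ⟨_, fun _ => rfl⟩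
  have hg_lip : IsLipschitzWithOn L g univ := by
    rw [funext hg]
    exact (isLipschitzWithOn_quadInfConv h2c hu_lip).neg
  have hg_diff : ∀ x h, |g (x + h) + g (x - h) - 2 * g x| ≤ 4 * c * ‖h‖ ^ 2 := by
    intro x h
    have h1 := quadInfConv_second_difference_le h2c hu_lip x h
    have h2 := le_quadInfConv_second_difference hc hu_lip hu_conv x h
    rw [hg, hg, hg, abs_le]
    constructor <;> linarith
  refine ⟨g, contDiff_one_of_abs_second_difference_le (by positivity) hg_lip
    (abs_second_difference_le_of_symmetric hg_diff), hg_lip, fun x => ?_⟩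
  have h1 := abs_sub_quadInfConv_le hc hf x
  have h2 := abs_sub_quadInfConv_le h2c hu_lip x
  rw [hu] at h2
  rw [hg]
  rw [abs_le] at h1 h2 ⊢
  constructor <;> linarith

end LasryLions

section StrictContraction

variable {X : Type*} [PseudoMetricSpace X]

theorem exists_arctan_sub_eq {R a b : ℝ} (ha : |a| ≤ R) (hb : |b| ≤ R) :
    ∃ q, 1 / (1 + R ^ 2) ≤ q ∧ q ≤ 1 ∧ Real.arctan a - Real.arctan b = q * (a - b) := by
  wlog hab : b < a generalizing a b
  · rcases eq_or_lt_of_le (not_lt.1 hab) with rfl | h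
    · refine ⟨1, ?_, le_rfl, by simp⟩
      rw [div_le_one (by positivity)]
      nlinarith [sq_nonneg R]
    · obtain ⟨q, h1, h2, h3⟩ := this hb ha h
      exact ⟨q, h1, h2, by linarith⟩
  obtain ⟨ξ, hξ, h⟩ := exists_hasDerivAt_eq_slope Real.arctan (fun x => 1 / (1 + x ^ 2)) hab
    Real.continuous_arctan.continuousOn fun x _ => Real.hasDerivAt_arctan x
  have hξR : ξ ^ 2 ≤ R ^ 2 := by
    rw [abs_le] at ha hb
    exact sq_le_sq' (by linarith [hξ.1]) (by linarith [hξ.2])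
  refine ⟨1 / (1 + ξ ^ 2), ?_, ?_, ?_⟩
  · gcongr
  · rw [div_le_one (by positivity)]
    nlinarith [sq_nonneg ξ]
  · rw [h, div_mul_cancel₀ _ (sub_ne_zero.2 hab.ne')]

/-- A `K`-Lipschitz function can be uniformly approximated by functions whose Lipschitz constant
is smaller than `K` on each ball, without changing it where it agrees with a given function of
smaller Lipschitz constant. -/
theorem IsLipschitzWithOn.exists_approx_lt_on_balls {K K₁ : ℝ} {u f : X → ℝ}
    (hu : IsLipschitzWithOn K u univ) (hf : IsLipschitzWithOn K₁ f univ) (hlt : K₁ < K)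
    {ε : ℝ} (hε : 0 < ε) :
    ∃ w : X → ℝ, (∀ x₀ R, ∃ K' < K, IsLipschitzWithOn K' w (ball x₀ R)) ∧
      (∀ x, u x = f x → w x = u x) ∧ ∀ x, |u x - w x| ≤ ε := by
  set δ : ℝ := min 1 (ε / 2) with hδ
  have hδ0 : 0 < δ := lt_min one_pos (half_pos hε)
  have hδ1 : δ ≤ 1 := min_le_left _ _
  refine ⟨fun x => u x - δ * Real.arctan (u x - f x), fun x₀ R => ?_, fun x hx => by simp [hx],
    fun x => ?_⟩
  · set r : ℝ := |u x₀ - f x₀| + (|K| + |K₁|) * R with hr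
    have hball : ∀ x ∈ ball x₀ R, |u x - f x| ≤ r := by
      intro x hx
      have hx' : dist x x₀ ≤ R := (mem_ball.1 hx).le
      have h1 := hu x trivial x₀ trivial
      have h2 := hf x trivial x₀ trivial
      have h3 : K * dist x x₀ ≤ |K| * R := by
        gcongr
        exact le_abs_self K
      have h4 : K₁ * dist x x₀ ≤ |K₁| * R := by
        gcongr
        exact le_abs_self K₁
      have h5 : u x - f x = (u x₀ - f x₀) + (u x - u x₀) - (f x - f x₀) := by ring
      rw [h5]
      refine (abs_sub _ _).trans ?_
      have := abs_add_le (u x₀ - f x₀) (u x - u x₀)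
      rw [hr]
      linarith
    have hgap : 0 < δ * (1 / (1 + r ^ 2)) * (K - K₁) := by
      have : 0 < K - K₁ := sub_pos.2 hlt
      positivity
    refine ⟨K - δ * (1 / (1 + r ^ 2)) * (K - K₁), by linarith, fun x hx y hy => ?_⟩
    obtain ⟨q, hq, hq1, h⟩ := exists_arctan_sub_eq (hball x hx) (hball y hy)
    have hq0 : 0 ≤ q := le_trans (by positivity) hq
    have h6 : u x - δ * Real.arctan (u x - f x) - (u y - δ * Real.arctan (u y - f y))
        = (1 - δ * q) * (u x - u y) + δ * q * (f x - f y) := by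
      linear_combination -δ * h
    have h7 : 0 ≤ 1 - δ * q := by nlinarith
    have h8 : δ * (1 / (1 + r ^ 2)) * (K - K₁) * dist x y ≤ δ * q * (K - K₁) * dist x y := by
      have : 0 < K - K₁ := sub_pos.2 hlt
      gcongr
    rw [h6]
    calc |(1 - δ * q) * (u x - u y) + δ * q * (f x - f y)|
        ≤ (1 - δ * q) * |u x - u y| + δ * q * |f x - f y| := by
          refine (abs_add_le _ _).trans_eq ?_
          rw [abs_mul, abs_mul, abs_of_nonneg h7, abs_of_nonneg (mul_nonneg hδ0.le hq0)]
      _ ≤ (1 - δ * q) * (K * dist x y) + δ * q * (K₁ * dist x y) := by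
          gcongr
          · exact hu x trivial y trivial
          · exact hf x trivial y trivial
      _ ≤ _ := by linarith
  · rw [sub_sub_cancel, abs_mul, abs_of_pos hδ0]
    have h1 : |Real.arctan (u x - f x)| ≤ 2 := by
      rw [abs_le]
      constructor <;>
        linarith [Real.arctan_lt_pi_div_two (u x - f x), Real.neg_pi_div_two_lt_arctan (u x - f x),
          Real.pi_lt_four]
    calc δ * |Real.arctan (u x - f x)| ≤ ε / 2 * 2 := by
          gcongr
          exact min_le_right _ _
      _ = ε := by ring

end StrictContraction

section MeanValue

variable {X : Type*} [NormedAddCommGroup X] [NormedSpace ℝ X]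

theorem abs_sub_le_of_lineMap_mem {Ω : Set X} {v : X → ℝ} {K : ℝ} (hv : Continuous v)
    (hd : ∀ x ∈ Ω, DifferentiableAt ℝ v x) (hb : ∀ x ∈ Ω, ‖fderiv ℝ v x‖ ≤ K) {x y : X}
    (hxy : ∀ t ∈ Ico (0 : ℝ) 1, AffineMap.lineMap x y t ∈ Ω) : |v x - v y| ≤ K * dist x y := by
  have h := norm_image_sub_le_of_norm_deriv_right_le_segment
    (f := fun t : ℝ => v (AffineMap.lineMap x y t))
    (f' := fun t => fderiv ℝ v (AffineMap.lineMap x y t) (y - x)) (C := K * dist x y)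
    (a := 0) (b := 1)
    (hv.comp AffineMap.lineMap_continuous).continuousOn
    (fun t ht => ((hd _ (hxy t ht)).hasFDerivAt.comp_hasDerivAt t
      AffineMap.hasDerivAt_lineMap).hasDerivWithinAt)
    (fun t ht => by
      rw [dist_comm, dist_eq_norm]
      exact ContinuousLinearMap.le_of_opNorm_le _ (hb _ (hxy t ht)) _)
    1 (right_mem_Icc.2 zero_le_one)
  simpa [abs_sub_comm] using h

/-- A continuous function which is `K`-Lipschitz off an open set and whose derivative is bounded
by `K` inside is `K`-Lipschitz. -/
theorem IsLipschitzWithOn.univ_of_fderiv_le {Ω : Set X} (hΩ : IsOpen Ω) {v : X → ℝ} {K : ℝ}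
    (hv : Continuous v) (hd : ∀ x ∈ Ω, DifferentiableAt ℝ v x)
    (hb : ∀ x ∈ Ω, ‖fderiv ℝ v x‖ ≤ K) (hc : IsLipschitzWithOn K v Ωᶜ) :
    IsLipschitzWithOn K v univ := by
  have hout : ∀ x, ∀ y ∉ Ω, |v x - v y| ≤ K * dist x y := by
    intro x y hy
    by_cases hx : x ∈ Ω
    swap
    · exact hc x hx y hy
    have hcomp : IsCompact (Icc (0 : ℝ) 1 ∩ AffineMap.lineMap x y ⁻¹' Ωᶜ) :=
      isCompact_Icc.inter_right (hΩ.isClosed_compl.preimage AffineMap.lineMap_continuous)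
    obtain ⟨t, ⟨ht, htΩ⟩, hmin⟩ := hcomp.exists_isLeast
      ⟨1, right_mem_Icc.2 zero_le_one, by simpa using hy⟩
    have ht0 : 0 < t := by
      refine lt_of_le_of_ne ht.1 ?_
      rintro rfl
      exact htΩ (by simpa using hx)
    set p : X := AffineMap.lineMap x y t with hp
    have h1 : |v x - v p| ≤ K * dist x p := by
      refine abs_sub_le_of_lineMap_mem hv hd hb fun s hs => ?_
      rw [hp, AffineMap.lineMap_lineMap_right]
      by_contra hcon
      have hst : s * t < t := by nlinarith [hs.2]
      exact absurd (hmin ⟨⟨mul_nonneg hs.1 ht.1, by linarith [ht.2]⟩, hcon⟩) (not_le.2 hst)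
    have h2 := hc p htΩ y hy
    have h3 : dist x p + dist p y = dist x y :=
      Wbtw.dist_add_dist (show Wbtw ℝ x p y from ⟨t, ht, rfl⟩)
    calc |v x - v y| ≤ |v x - v p| + |v p - v y| := abs_sub_le _ _ _
      _ ≤ K * dist x p + K * dist p y := add_le_add h1 h2
      _ = K * dist x y := by rw [← h3]; ring
  intro x _ y _
  by_cases h : ∀ t ∈ Ico (0 : ℝ) 1, AffineMap.lineMap x y t ∈ Ω
  · exact abs_sub_le_of_lineMap_mem hv hd hb h
  · push Not at h
    obtain ⟨t, ht, htΩ⟩ := h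
    set p : X := AffineMap.lineMap x y t with hp
    have h1 := hout x p htΩ
    have h2 := hout y p htΩ
    rw [abs_sub_comm, dist_comm] at h2
    have h3 : dist x p + dist p y = dist x y :=
      Wbtw.dist_add_dist (show Wbtw ℝ x p y from ⟨t, Ico_subset_Icc_self ht, rfl⟩)
    calc |v x - v y| ≤ |v x - v p| + |v p - v y| := abs_sub_le _ _ _
      _ ≤ K * dist x p + K * dist p y := add_le_add h1 h2
      _ = K * dist x y := by rw [← h3]; ring

end MeanValue

section Gluing

/-- Every open set carries a `1`-Lipschitz weight, positive exactly on the set, which decays at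
infinity. -/
theorem exists_lipschitz_weight {X : Type*} [NormedAddCommGroup X] {Ω : Set X} (hΩ : IsOpen Ω) :
    ∃ σ : X → ℝ, IsLipschitzWithOn 1 σ univ ∧ (∀ x, 0 ≤ σ x) ∧ (∀ x, σ x ≤ 1) ∧
      (∀ x, x ∈ Ω ↔ 0 < σ x) ∧ ∀ x, σ x * ‖x‖ ≤ 1 := by
  obtain ⟨d, hd, hd0, hdΩ⟩ : ∃ d : X → ℝ, IsLipschitzWithOn 1 d univ ∧ (∀ x, 0 ≤ d x) ∧
      ∀ x, x ∈ Ω ↔ 0 < d x := by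
    rcases (Ωᶜ).eq_empty_or_nonempty with h | h
    · rw [compl_empty_iff] at h
      exact ⟨fun _ => 1, fun x _ y _ => by simp, fun _ => zero_le_one, fun x => by simp [h]⟩
    · refine ⟨fun x => infDist x Ωᶜ, fun x _ y _ => ?_, fun x => infDist_nonneg, fun x => ?_⟩
      · simpa [Real.dist_eq] using (lipschitz_infDist_pt Ωᶜ).dist_le_mul x y
      · rw [← hΩ.isClosed_compl.notMem_iff_infDist_pos h, notMem_compl_iff]
  refine ⟨fun x => min (d x) (1 / (1 + ‖x‖)), fun x _ y _ => ?_, fun x => ?_, fun x => ?_,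
    fun x => ?_, fun x => ?_⟩
  · refine (abs_min_sub_min_le_max _ _ _ _).trans (max_le (hd x trivial y trivial) ?_)
    have h1 : 1 / (1 + ‖x‖) - 1 / (1 + ‖y‖) = (‖y‖ - ‖x‖) / ((1 + ‖x‖) * (1 + ‖y‖)) := by
      have := norm_nonneg x
      have := norm_nonneg y
      field_simp
      ring
    have h2 : 1 ≤ (1 + ‖x‖) * (1 + ‖y‖) :=
      one_le_mul_of_one_le_of_one_le (by linarith [norm_nonneg x]) (by linarith [norm_nonneg y])
    rw [h1, abs_div, abs_of_pos (by linarith : 0 < (1 + ‖x‖) * (1 + ‖y‖)), one_mul]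
    refine (div_le_self (abs_nonneg _) h2).trans ?_
    rw [abs_sub_comm, dist_eq_norm]
    exact abs_norm_sub_norm_le x y
  · exact le_min (hd0 x) (by positivity)
  · refine (min_le_right _ _).trans ?_
    rw [div_le_one (by positivity)]
    linarith [norm_nonneg x]
  · rw [hdΩ, lt_min_iff, and_iff_left (by positivity)]
  · calc min (d x) (1 / (1 + ‖x‖)) * ‖x‖ ≤ 1 / (1 + ‖x‖) * ‖x‖ := by
          gcongr
          exact min_le_right _ _
      _ ≤ 1 := by
          rw [div_mul_eq_mul_div, div_le_one (by positivity)]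
          linarith

variable {X : Type*} [NormedAddCommGroup X]

theorem IsLipschitzWithOn.norm_fderiv_le [NormedSpace ℝ X] {K : ℝ} {f : X → ℝ} (hK : 0 ≤ K)
    (hf : IsLipschitzWithOn K f univ) (x : X) : ‖fderiv ℝ f x‖ ≤ K := by
  lift K to NNReal using hK
  exact norm_fderiv_le_of_lipschitz ℝ
    (LipschitzWith.of_dist_le_mul fun x y => hf x trivial y trivial)

variable [InnerProductSpace ℝ X]

theorem exists_contDiff_one_cutoff {σ : X → ℝ} {L a b : ℝ} (hL : 0 ≤ L)
    (hσ : IsLipschitzWithOn L σ univ) (hσ0 : ∀ x, 0 ≤ σ x) (ha : 0 < a) (hab : a < b) :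
    ∃ (θ : X → ℝ) (M : ℝ), ContDiff ℝ 1 θ ∧ 0 < M ∧ IsLipschitzWithOn M θ univ ∧
      (∀ x, 0 ≤ θ x) ∧ (∀ x, θ x ≤ 1) ∧ (∀ x, σ x ≤ a → θ x = 1) ∧ ∀ x, b ≤ σ x → θ x = 0 := by
  obtain ⟨s, hs, hsL, hσs⟩ := hσ.exists_contDiff_one_approx (η := (b - a) / 4) (by linarith)
  let φ : ContDiffBump (0 : ℝ) := ⟨a + (b - a) / 4, b - (b - a) / 4, by linarith, by linarith⟩
  have hφ : ContDiff ℝ 1 φ := φ.contDiff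
  obtain ⟨C, hC⟩ := ContDiff.lipschitzWith_of_hasCompactSupport φ.hasCompactSupport hφ one_ne_zero
  refine ⟨fun x => φ (s x), C * L + 1, hφ.comp hs, by positivity, fun x _ y _ => ?_,
    fun x => φ.nonneg, fun x => φ.le_one, fun x hx => φ.one_of_mem_closedBall ?_,
    fun x hx => φ.zero_of_le_dist ?_⟩
  · calc |φ (s x) - φ (s y)| ≤ C * |s x - s y| := hC.dist_le_mul _ _
      _ ≤ C * (L * dist x y) := by
          gcongr
          exact hsL x trivial y trivial
      _ ≤ (C * L + 1) * dist x y := by linarith [dist_nonneg (x := x) (y := y)]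
  · have h1 := abs_le.1 (hσs x)
    rw [mem_closedBall_zero_iff, Real.norm_eq_abs, abs_le]
    change -(a + (b - a) / 4) ≤ s x ∧ s x ≤ a + (b - a) / 4
    constructor <;> linarith [hσ0 x]
  · have h1 := abs_le.1 (hσs x)
    rw [Real.dist_eq, sub_zero]
    change b - (b - a) / 4 ≤ |s x|
    linarith [le_abs_self (s x)]

theorem norm_fderiv_interpolation_le {f g θ : X → ℝ} {κ M e : ℝ} {x : X}
    (hf : DifferentiableAt ℝ f x) (hg : DifferentiableAt ℝ g x) (hθ : DifferentiableAt ℝ θ x)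
    (hf' : ‖fderiv ℝ f x‖ ≤ κ) (hg' : ‖fderiv ℝ g x‖ ≤ κ) (hθ' : ‖fderiv ℝ θ x‖ ≤ M)
    (h0 : 0 ≤ θ x) (h1 : θ x ≤ 1) (hfg : |g x - f x| ≤ e) :
    ‖fderiv ℝ (fun y => f y + θ y * (g y - f y)) x‖ ≤ κ + e * M := by
  have h : HasFDerivAt (fun y => f y + θ y * (g y - f y))
      (fderiv ℝ f x + (θ x • (fderiv ℝ g x - fderiv ℝ f x) + (g x - f x) • fderiv ℝ θ x)) x :=
    hf.hasFDerivAt.add (hθ.hasFDerivAt.mul (hg.hasFDerivAt.sub hf.hasFDerivAt))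
  have h2 : fderiv ℝ f x + (θ x • (fderiv ℝ g x - fderiv ℝ f x) + (g x - f x) • fderiv ℝ θ x)
      = (1 - θ x) • fderiv ℝ f x + θ x • fderiv ℝ g x + (g x - f x) • fderiv ℝ θ x := by
    module
  rw [h.fderiv, h2]
  have he : 0 ≤ e := (abs_nonneg _).trans hfg
  calc _ ≤ ‖(1 - θ x) • fderiv ℝ f x‖ + ‖θ x • fderiv ℝ g x‖ + ‖(g x - f x) • fderiv ℝ θ x‖ :=
        norm_add₃_le
    _ ≤ (1 - θ x) * κ + θ x * κ + e * M := by
        rw [norm_smul, norm_smul, norm_smul, Real.norm_of_nonneg h0,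
          Real.norm_of_nonneg (sub_nonneg.2 h1), Real.norm_eq_abs]
        have := sub_nonneg.2 h1
        gcongr
    _ = κ + e * M := by ring

/-- A function whose Lipschitz constant is smaller than `K` on each ball can be approximated by
functions of class `C¹` on an open set, with derivative bounded by `K` there, without changing it
off the open set. -/
theorem exists_contDiffOn_approx_of_lipschitz_lt_on_balls {Ω : Set X} (hΩ : IsOpen Ω) {K : ℝ}
    (hK : 0 < K)
    {w : X → ℝ} (hw : Continuous w) (hloc : ∀ R, ∃ K' < K, IsLipschitzWithOn K' w (ball 0 R))
    {ε : ℝ} (hε : 0 < ε) :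
    ∃ v : X → ℝ, Continuous v ∧ ContDiffOn ℝ 1 v Ω ∧ (∀ x ∈ Ω, ‖fderiv ℝ v x‖ ≤ K) ∧
      (∀ x ∉ Ω, v x = w x) ∧ ∀ x, |v x - w x| ≤ ε := by
  classical
  obtain ⟨σ, hσ, hσ0, hσ1, hσΩ, hσn⟩ := exists_lipschitz_weight hΩ
  set t : ℕ → ℝ := fun k => (1 / 4) ^ k with ht
  have ht0 : ∀ k, 0 < t k := fun k => by positivity
  have hts : ∀ k, t (k + 1) = t k / 4 := fun k => by simp only [ht, pow_succ]; ring
  have hta : Antitone t := pow_right_anti₀ (by norm_num) (by norm_num)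
  have hcut := fun k => exists_contDiff_one_cutoff zero_le_one hσ hσ0
    (a := 2 * t k) (b := 3 * t k) (by linarith [ht0 k]) (by linarith [ht0 k])
  choose θ M hθ hM hθL hθ0 hθ1 hθone hθzero using hcut
  have hloc' : ∀ R, ∃ κ, 0 ≤ κ ∧ κ < K ∧ IsLipschitzWithOn κ w (ball 0 R) := by
    intro R
    obtain ⟨K', hK', h⟩ := hloc R
    refine ⟨max K' 0, le_max_right _ _, max_lt hK' hK, fun x hx y hy => (h x hx y hy).trans ?_⟩
    gcongr
    exact le_max_left _ _
  choose κ hκ0 hκK hκ using fun k => hloc' (1 / t (k + 1))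
  set m : ℕ → ℝ := fun k => max (κ k) (κ (k + 1)) with hm
  have hmK : ∀ k, m k < K := fun k => max_lt (hκK _) (hκK _)
  set e : ℕ → ℝ := fun k => min (min ε (t (k + 1))) ((K - m k) / (2 * M k)) with he
  have he0 : ∀ k, 0 < e k := fun k =>
    lt_min (lt_min hε (ht0 _)) (div_pos (sub_pos.2 (hmK k)) (mul_pos two_pos (hM k)))
  have happrox : ∀ k, ∃ g : X → ℝ, ContDiff ℝ 1 g ∧ IsLipschitzWithOn (κ k) g univ ∧
      ∀ x ∈ ball (0 : X) (1 / t (k + 1)), |w x - g x| ≤ min (e k) (e (k - 1)) := by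
    intro k
    obtain ⟨f, hf, hfw⟩ := (hκ k).exists_extension_s3 (hκ0 k)
    obtain ⟨g, hg, hgL, hgf⟩ := hf.exists_contDiff_one_approx (lt_min (he0 k) (he0 (k - 1)))
    exact ⟨g, hg, hgL, fun x hx => hfw hx ▸ hgf x⟩
  choose W hW hWL hWw using happrox
  set V : ℕ → Set X := fun k => {x | 3 * t (k + 1) < σ x ∧ σ x < 8 * t k} with hV
  set F : ℕ → X → ℝ := fun k x => W k x + θ k x * (W (k + 1) x - W k x) with hF
  have hVopen : ∀ k, IsOpen (V k) := fun k =>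
    (isOpen_lt continuous_const hσ.continuous).inter (isOpen_lt hσ.continuous continuous_const)
  have hVΩ : ∀ k, V k ⊆ Ω := fun k x hx => (hσΩ x).2 (by linarith [hx.1, ht0 (k + 1)])
  have hcover : ∀ x, ∃ k, x ∈ Ω → x ∈ V k := by
    intro x
    by_cases hx : x ∈ Ω
    swap
    · exact ⟨0, fun h => absurd h hx⟩
    obtain ⟨k, h1, h2⟩ := exists_nat_pow_near_of_lt_one (x := σ x / 3) (y := (1 / 4 : ℝ))
      (by linarith [(hσΩ x).1 hx]) (by linarith [hσ1 x]) (by norm_num) (by norm_num)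
    change t (k + 1) < _ at h1
    change _ ≤ t k at h2
    exact ⟨k, fun _ => ⟨by linarith, by linarith [ht0 k]⟩⟩
  choose N hN using hcover
  have hoverlap : ∀ j k x, j < k → x ∈ V j → x ∈ V k → F j x = F k x := by
    intro j k x hjk hj hk
    have hkj : k = j + 1 := by
      by_contra hne
      have h1 := hta (show j + 2 ≤ k by omega)
      linarith [hj.1, hk.2, hts j, hts (j + 1), ht0 j]
    subst hkj
    have h1 : θ j x = 1 := hθone j x (by linarith [hk.2, hts j])
    have h2 : θ (j + 1) x = 0 := hθzero (j + 1) x hj.1.le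
    simp [hF, h1, h2]
  set v : X → ℝ := fun x => if x ∈ Ω then F (N x) x else w x with hv
  have hvF : ∀ k, ∀ x ∈ V k, v x = F k x := by
    intro k x hx
    have hxΩ := hVΩ k hx
    simp only [hv, if_pos hxΩ]
    rcases lt_trichotomy (N x) k with h | h | h
    · exact hoverlap _ _ x h (hN x hxΩ) hx
    · rw [h]
    · exact (hoverlap _ _ x h hx (hN x hxΩ)).symm
  have hvout : ∀ x ∉ Ω, v x = w x := fun x hx => if_neg hx
  have hveq : ∀ k, ∀ x ∈ V k, v =ᶠ[𝓝 x] F k := fun k x hx =>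
    Filter.eventuallyEq_of_mem ((hVopen k).mem_nhds hx) (hvF k)
  have hFdiff : ∀ k, ContDiff ℝ 1 (F k) := fun k => (hW k).add ((hθ k).mul ((hW _).sub (hW k)))
  have hball : ∀ k, ∀ x ∈ V k, |w x - W k x| ≤ e k ∧ |w x - W (k + 1) x| ≤ e k := by
    intro k x hx
    have hn : ‖x‖ < 1 / t (k + 1) := by
      rw [lt_div_iff₀ (ht0 _)]
      have hσx := (hσΩ x).1 (hVΩ k hx)
      rcases (norm_nonneg x).eq_or_lt with h | h
      · rw [← h]; norm_num
      · nlinarith [hσn x, hx.1, ht0 (k + 1), mul_lt_mul_of_pos_left hx.1 h]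
    have hn' : ‖x‖ < 1 / t (k + 1 + 1) :=
      hn.trans_le (one_div_le_one_div_of_le (ht0 _) (hta (Nat.le_succ _)))
    exact ⟨(hWw k x (mem_ball_zero_iff.2 hn)).trans (min_le_left _ _),
      (hWw (k + 1) x (mem_ball_zero_iff.2 hn')).trans (min_le_right _ _)⟩
  have hvw : ∀ k, ∀ x ∈ V k, |v x - w x| ≤ e k := by
    intro k x hx
    obtain ⟨h1, h2⟩ := hball k x hx
    rw [abs_sub_comm] at h1 h2
    rw [hvF k x hx, show F k x - w x = (1 - θ k x) * (W k x - w x) + θ k x * (W (k + 1) x - w x) by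
      simp only [hF]; ring]
    have h3 := sub_nonneg.2 (hθ1 k x)
    calc _ ≤ (1 - θ k x) * |W k x - w x| + θ k x * |W (k + 1) x - w x| := by
          refine (abs_add_le _ _).trans_eq ?_
          rw [abs_mul, abs_mul, abs_of_nonneg h3, abs_of_nonneg (hθ0 k x)]
      _ ≤ (1 - θ k x) * e k + θ k x * e k := by
          have := hθ0 k x
          gcongr
      _ = e k := by ring
  have hvσ : ∀ x, |v x - w x| ≤ min ε (σ x) := by
    intro x
    by_cases hx : x ∈ Ω
    · have hk := hN x hx
      refine ((hvw _ x hk).trans (min_le_left _ _)).trans (min_le_min_left _ ?_)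
      linarith [hk.1, ht0 (N x + 1)]
    · rw [hvout x hx, sub_self, abs_zero]
      exact le_min hε.le (hσ0 x)
  refine ⟨v, ?_, ?_, ?_, hvout, fun x => (hvσ x).trans (min_le_left _ _)⟩
  · refine continuous_iff_continuousAt.2 fun x => ?_
    by_cases hx : x ∈ Ω
    · exact (hFdiff (N x)).continuous.continuousAt.congr (hveq _ x (hN x hx)).symm
    · have hσx : σ x = 0 := le_antisymm (not_lt.1 fun h => hx ((hσΩ x).2 h)) (hσ0 x)
      have h1 : Tendsto (fun y => v y - w y) (𝓝 x) (𝓝 0) :=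
        squeeze_zero_norm (fun y => (hvσ y).trans (min_le_right _ _))
          (hσx ▸ hσ.continuous.tendsto x)
      have h2 := h1.add (hw.tendsto x)
      simpa [ContinuousAt, hvout x hx] using h2
  · intro x hx
    exact ((hFdiff (N x)).contDiffAt.congr_of_eventuallyEq (hveq _ x (hN x hx))).contDiffWithinAt
  · intro x hx
    set k := N x
    have hk : x ∈ V k := hN x hx
    rw [(hveq k x hk).fderiv_eq]
    obtain ⟨h1, h2⟩ := hball k x hk
    have h3 : |W (k + 1) x - W k x| ≤ 2 * e k := by
      rw [abs_le] at h1 h2 ⊢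
      constructor <;> linarith
    have hd : ∀ {f : X → ℝ}, ContDiff ℝ 1 f → DifferentiableAt ℝ f x := fun hf =>
      hf.differentiable one_ne_zero x
    refine (norm_fderiv_interpolation_le (hd (hW k)) (hd (hW (k + 1))) (hd (hθ k))
      (((hWL k).norm_fderiv_le (hκ0 k) x).trans (le_max_left _ _))
      (((hWL (k + 1)).norm_fderiv_le (hκ0 _) x).trans (le_max_right _ _))
      ((hθL k).norm_fderiv_le (hM k).le x) (hθ0 k x) (hθ1 k x) h3).trans ?_
    have h4 : e k ≤ (K - m k) / (2 * M k) := min_le_right _ _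
    rw [le_div_iff₀ (mul_pos two_pos (hM k))] at h4
    change m k + _ ≤ K
    linarith

end Gluing

/-- Approximation of Lipschitz functions preserving boundary values and the Lipschitz
constant, by functions of class `C¹`, in a (not necessarily separable) Hilbert space. -/
theorem stmt_3 {X : Type*} [NormedAddCommGroup X] [InnerProductSpace ℝ X] [CompleteSpace X]
    (Ω : Set X) (hΩ : IsOpen Ω) (u₀ : X → ℝ)
    (hu₀ : ∃ K : ℝ, IsLipschitzWithOn K u₀ (closure Ω))
    (hlt : lipOn u₀ (frontier Ω) < lipOn u₀ (closure Ω))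
    (ε : ℝ) (hε : 0 < ε) :
    ∃ v : X → ℝ,
      ContDiffOn ℝ 1 v Ω ∧
      IsLipschitzWithOn (lipOn u₀ (closure Ω)) v (closure Ω) ∧
      lipOn v (closure Ω) ≤ lipOn u₀ (closure Ω) ∧
      (∀ x ∈ frontier Ω, v x = u₀ x) ∧
      (∀ x ∈ closure Ω, |u₀ x - v x| ≤ ε) := by
  obtain ⟨L, hL⟩ := hu₀
  have hne : ∀ s ⊆ closure Ω,
      {L : ℝ | 0 < L ∧ ∀ x ∈ s, ∀ y ∈ s, |u₀ x - u₀ y| ≤ L * dist x y}.Nonempty := by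
    refine fun s hs => ⟨max L 1, by positivity, fun x hx y hy => ?_⟩
    refine (hL x (hs hx) y (hs hy)).trans ?_
    gcongr
    exact le_max_left _ _
  have hbdd : ∀ (f : X → ℝ) (s : Set X),
      BddBelow {L : ℝ | 0 < L ∧ ∀ x ∈ s, ∀ y ∈ s, |f x - f y| ≤ L * dist x y} :=
    fun f s => ⟨0, fun L hL => hL.1.le⟩
  obtain ⟨K₁, ⟨hK₁, hK₁f⟩, hK₁K⟩ := exists_lt_of_csInf_lt (hne _ frontier_subset_closure) hlt
  have hK : IsLipschitzWithOn (lipOn u₀ (closure Ω)) u₀ (closure Ω) := by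
    intro x hx y hy
    rcases (dist_nonneg (x := x) (y := y)).eq_or_lt with h | h
    · simpa [← h] using hL x hx y hy
    · rw [← div_le_iff₀ h]
      exact le_csInf (hne _ subset_rfl) fun l hl => (div_le_iff₀ h).2 (hl.2 x hx y hy)
  set K := lipOn u₀ (closure Ω)
  have hK0 : 0 < K := hK₁.trans hK₁K
  obtain ⟨u, hu, huu₀⟩ := hK.exists_extension_s3 hK0.le
  obtain ⟨f, hf, hfu₀⟩ := IsLipschitzWithOn.exists_extension_s3 hK₁.le hK₁f
  obtain ⟨w, hwloc, hwf, hwu⟩ := hu.exists_approx_lt_on_balls hf hK₁K (half_pos hε)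
  have hw : IsLipschitzWithOn K w univ := by
    intro x _ y _
    obtain ⟨K', hK', h⟩ := hwloc x (dist y x + 1)
    refine (h x (mem_ball_self (by positivity)) y (mem_ball.2 (lt_add_one _))).trans ?_
    gcongr
  obtain ⟨v, hvc, hvd, hvK, hvw, hvε⟩ :=
    exists_contDiffOn_approx_of_lipschitz_lt_on_balls hΩ hK0 hw.continuous (hwloc 0)
      (half_pos hε)
  have hv : IsLipschitzWithOn K v univ := by
    refine IsLipschitzWithOn.univ_of_fderiv_le hΩ hvc
      (fun x hx => (hvd.contDiffAt (hΩ.mem_nhds hx)).differentiableAt one_ne_zero) hvK ?_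
    intro x hx y hy
    rw [hvw x hx, hvw y hy]
    exact hw x trivial y trivial
  have hvcl : IsLipschitzWithOn K v (closure Ω) := fun x _ y _ => hv x trivial y trivial
  refine ⟨v, hvd, hvcl, csInf_le (hbdd _ _) ⟨hK0, hvcl⟩, fun x hx => ?_, fun x hx => ?_⟩
  · have hxΩ : x ∉ Ω := fun h => (hΩ.inter_frontier_eq.subset ⟨h, hx⟩ : x ∈ (∅ : Set X))
    have hxu : u₀ x = u x := huu₀ (frontier_subset_closure hx)
    rw [hvw x hxΩ, hwf x (hxu.symm.trans (hfu₀ hx)), hxu]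
  · have h1 := hwu x
    have h2 := hvε x
    rw [huu₀ hx]
    rw [abs_le] at h1 h2 ⊢
    constructor <;> linarith
end
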